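/- arXiv:2305.05013 — 5 statements merged into one kernel-verified Lean document; each statement's English description precedes it below -/
import Mathlib

section
/- Let N ≥ 2, let G be a tree on the vertex set Fin N, and let α ∈ ℂ^N be such that for every edge {n,m} of G the complex numbers α_n and α_m are ℝ-linearly independent. Then the real-linear map B ↦ B·α (matrix–vector product, with the real matrix B regarded as a complex matrix), defined on the real vector space of real symmetric N×N matrices supported on G, is injective. -/
theorem tree_aux (n : ℕ) : ∀ (V : Type) [Fintype V] [DecidableEq V] (_ : Fintype.card V = n)
    (G : SimpleGraph V) (_ : G.IsTree) (α : V → ℂ)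
    (_ : ∀ n m, G.Adj n m → LinearIndependent ℝ ![α n, α m]) (_ : ∀ n, α n ≠ 0)
    (C : V → V → ℝ) (_ : ∀ i j, C i j = C j i)
    (_ : ∀ i j, i ≠ j → ¬ G.Adj i j → C i j = 0)
    (_ : ∀ i, ∑ j, C i j • α j = 0), ∀ i j, C i j = 0 := by
  classical
  induction n with
  | zero =>
    intro V _ _ hc G hG α hα h0 C hs hsup hsum i
    exact ((Fintype.card_eq_zero_iff.mp hc).false i).elim
  | succ n ih =>
    intro V _ _ hc G hG α hα h0 C hs hsup hsum
    rcases subsingleton_or_nontrivial V with hV | hV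
    · intro i j
      obtain rfl := Subsingleton.elim i j
      have h := hsum i
      rw [Fintype.sum_subsingleton _ i, smul_eq_zero] at h
      exact h.resolve_right (h0 i)
    · obtain ⟨v, hv⟩ := hG.exists_vert_degree_one_of_nontrivial
      obtain ⟨u, hu, huniq⟩ := (SimpleGraph.degree_eq_one_iff_existsUnique_adj).mp hv
      have hne : v ≠ u := hu.ne
      have hz : ∀ j, j ≠ v → j ≠ u → C v j = 0 := fun j hj hj' =>
        hsup v j hj.symm (fun h => hj' (huniq j h))
      have h1 : C v v • α v + C v u • α u = 0 := by
        rw [← hsum v, ← Finset.sum_pair (f := fun j => C v j • α j) hne]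
        apply Finset.sum_subset (Finset.subset_univ _)
        intro j _ hj
        simp only [Finset.mem_insert, Finset.mem_singleton, not_or] at hj
        rw [hz j hj.1 hj.2, zero_smul]
      obtain ⟨hvv, hvu⟩ := LinearIndependent.pair_iff.mp (hα v u hu) _ _ h1
      have hrow : ∀ j, C v j = 0 := by
        intro j
        by_cases hj : j = v
        · rw [hj, hvv]
        by_cases hj' : j = u
        · rw [hj', hvu]
        exact hz j hj hj'
      have key := ih ({v}ᶜ : Set V) (by
          rw [Fintype.card_compl_set, hc]; simp) (G.induce ({v}ᶜ : Set V))
        ⟨hG.connected.induce_compl_singleton_of_degree_eq_one hv, hG.isAcyclic.induce _⟩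
        (fun i => α i) (fun i j h => hα i j h) (fun i => h0 i) (fun i j => C i j)
        (fun i j => hs i j)
        (fun i j hij h => hsup i j (fun e => hij (Subtype.ext e)) h)
        (fun i => by
          have h := hsum i
          rw [← Finset.add_sum_erase _ _ (Finset.mem_univ v), hs, hrow, zero_smul, zero_add] at h
          rw [← h]
          symm
          apply Finset.sum_subtype (Finset.univ.erase v) (p := fun x => x ∈ ({v}ᶜ : Set V))
            (f := fun j => C i j • α j)
          intro x; simp)
      intro i j
      by_cases hi : i = v
      · rw [hi, hrow]
      by_cases hj : j = v
      · rw [hj, hs, hrow]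
      exact key ⟨i, hi⟩ ⟨j, hj⟩


/-- A real matrix `B` is *supported on* a simple graph `G` on `Fin N` if every
off-diagonal entry corresponding to a non-edge of `G` vanishes. -/
def SupportedOn {N : ℕ} (G : SimpleGraph (Fin N)) (B : Matrix (Fin N) (Fin N) ℝ) : Prop :=
  ∀ n m, n ≠ m → ¬ G.Adj n m → B n m = 0

/-- Let `N ≥ 2`, let `G` be a tree on `Fin N`, and let `α ∈ ℂ^N`
be such that for every edge `{n,m}` of `G` the complex numbers `α n` and `α m`
are `ℝ`-linearly independent.  Then the map `B ↦ B · α`, defined on the real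
symmetric `N × N` matrices supported on `G`, is injective. -/
theorem tree_mulVec_injective {N : ℕ} (hN : 2 ≤ N) (G : SimpleGraph (Fin N))
    (hG : G.IsTree) (α : Fin N → ℂ)
    (hα : ∀ n m, G.Adj n m → LinearIndependent ℝ ![α n, α m]) :
    Set.InjOn (fun B : Matrix (Fin N) (Fin N) ℝ => (B.map (Complex.ofReal)).mulVec α)
      {B | B.IsSymm ∧ SupportedOn G B} := by
  intro A hA B hB hAB
  have : Nontrivial (Fin N) := Fin.nontrivial_iff_two_le.mpr hN
  have h := tree_aux N (Fin N) (Fintype.card_fin N) G hG α hα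
    (fun i => by
      obtain ⟨j, hj⟩ := hG.connected.preconnected.exists_adj_of_nontrivial i
      exact (hα i j hj).ne_zero 0)
    (fun i j => A i j - B i j)
    (fun i j => by rw [hA.1.apply, hB.1.apply])
    (fun i j hij h => by rw [hA.2 i j hij h, hB.2 i j hij h, sub_zero])
    (fun i => by
      have h := congrFun hAB i
      simp only [Matrix.mulVec, dotProduct, Matrix.map_apply] at h
      simp only [sub_smul, Finset.sum_sub_distrib, Complex.real_smul]
      exact sub_eq_zero.mpr h)
  ext i j
  exact sub_eq_zero.mp (h i j)
end

section
/- Let α₁, α₂ ∈ ℂ be ℝ-linearly independent. Then the real 4×3 matrix with rows (Re α₁, 0, Re α₂), (0, Re α₂, Re α₁), (Im α₁, 0, Im α₂), (0, Im α₂, Im α₁) has rank 3, i.e., its three columns are linearly independent over ℝ. -/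
/-- If `α₁, α₂ ∈ ℂ` are `ℝ`-linearly independent, then the real
`4 × 3` matrix with rows `(Re α₁, 0, Re α₂)`, `(0, Re α₂, Re α₁)`,
`(Im α₁, 0, Im α₂)`, `(0, Im α₂, Im α₁)` has rank `3`, i.e. its columns are
linearly independent over `ℝ`. -/
theorem base_case_full_column_rank (α₁ α₂ : ℂ)
    (h : LinearIndependent ℝ ![α₁, α₂]) :
    LinearIndependent ℝ
      (Matrix.transpose (Matrix.of
        ![![α₁.re, 0, α₂.re],
          ![0, α₂.re, α₁.re],
          ![α₁.im, 0, α₂.im],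
          ![0, α₂.im, α₁.im]])) := by
  rw [LinearIndependent.pair_iff] at h
  refine Fintype.linearIndependent_iff.mpr ?_
  intro g hg
  have e0 := congrFun hg 0
  have e1 := congrFun hg 1
  have e2 := congrFun hg 2
  have e3 := congrFun hg 3
  simp [Fin.sum_univ_three, Matrix.transpose_apply] at e0 e1 e2 e3
  have h1 := h (g 0) (g 2) (by
    apply Complex.ext <;> simp <;> linarith)
  have h2 := h (g 2) (g 1) (by
    apply Complex.ext <;> simp <;> linarith)
  intro i
  fin_cases i
  · exact h1.1
  · exact h2.2
  · exact h1.2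
end

section
/- Let N ≥ 2, let G be a tree on the vertex set Fin N, let Z₀ > 0 be real, and let u, h ∈ ℂ^N with ‖u‖ = 1 and ‖h‖ = 1. Define α = i·Z₀·(u + h) and β = u − h, and assume that for every edge {n,m} of G the complex numbers α_n and α_m are ℝ-linearly independent. Then there exists a real symmetric N×N matrix B supported on G such that B·α = β (matrix–vector product with B regarded as a complex matrix). -/
lemma tsc_flow_pair {V : Type*} [Fintype V] [DecidableEq V] (G : SimpleGraph V)
    {a r : V} (w : G.Walk a r) :
    ∃ f : V → V → ℝ, (∀ n m, f n m = - f m n) ∧ (∀ n m, ¬ G.Adj n m → f n m = 0) ∧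
      ∀ n, ∑ m, f n m = (if n = a then 1 else 0) - (if n = r then 1 else 0) := by
  induction w with
  | nil => exact ⟨fun _ _ => 0, by simp, by simp, by simp⟩
  | @cons a b r hab p ih =>
    obtain ⟨f, h1, h2, h3⟩ := ih
    refine ⟨fun n m => f n m + ((if n = a then 1 else 0) * (if m = b then 1 else 0)
      - (if n = b then 1 else 0) * (if m = a then 1 else 0)), ?_, ?_, ?_⟩
    · intro n m
      simp only
      rw [h1 n m]; ring
    · intro n m hnm
      simp only
      rw [h2 n m hnm]
      have e1 : ¬ (n = a ∧ m = b) := by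
        rintro ⟨rfl, rfl⟩; exact hnm hab
      have e2 : ¬ (n = b ∧ m = a) := by
        rintro ⟨rfl, rfl⟩; exact hnm hab.symm
      grind
    · intro n
      rw [Finset.sum_add_distrib, h3, Finset.sum_sub_distrib, ← Finset.mul_sum, ← Finset.mul_sum]
      simp

lemma tsc_flow {V : Type*} [Fintype V] [DecidableEq V] (G : SimpleGraph V)
    (hG : G.Connected) (c : V → ℝ) (hc : ∑ n, c n = 0) :
    ∃ f : V → V → ℝ, (∀ n m, f n m = - f m n) ∧ (∀ n m, ¬ G.Adj n m → f n m = 0) ∧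
      ∀ n, ∑ m, f n m = c n := by
  obtain ⟨r⟩ := hG.nonempty
  choose g g1 g2 g3 using fun a => tsc_flow_pair G (hG.preconnected a r).some
  refine ⟨fun n m => ∑ a, c a * g a n m, ?_, ?_, ?_⟩
  · intro n m
    rw [← Finset.sum_neg_distrib]
    refine Finset.sum_congr rfl fun a _ => ?_
    rw [g1 a n m]; ring
  · intro n m h
    exact Finset.sum_eq_zero fun a _ => by rw [g2 a n m h, mul_zero]
  · intro n
    rw [Finset.sum_comm]
    simp_rw [← Finset.mul_sum, g3, mul_sub, Finset.sum_sub_distrib, ← Finset.sum_mul, hc]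
    simp

lemma tsc_im_ne {a b : ℂ} (h : LinearIndependent ℝ ![a, b]) :
    a.re * b.im - a.im * b.re ≠ 0 := by
  intro h0
  have ha : a ≠ 0 := h.ne_zero 0
  rw [LinearIndependent.pair_iff] at h
  have := (h (a.re * b.re + a.im * b.im) (-(a.re * a.re + a.im * a.im)) (by
    apply Complex.ext
    · simp
      linear_combination a.im * h0
    · simp
      linear_combination -a.re * h0)).2
  apply ha
  apply Complex.ext <;> simp <;> nlinarith [sq_nonneg a.re, sq_nonneg a.im]

lemma tsc_main {V : Type*} [Fintype V] [DecidableEq V] (G : SimpleGraph V)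
    (hG : G.Connected) (α β : V → ℂ) (h0 : ∀ n, α n ≠ 0)
    (hα : ∀ n m, G.Adj n m → LinearIndependent ℝ ![α n, α m])
    (hs : ∑ n, ((α n).re * (β n).im - (α n).im * (β n).re) = 0) :
    ∃ B : Matrix V V ℝ, B.IsSymm ∧ (∀ n m, n ≠ m → ¬ G.Adj n m → B n m = 0) ∧
      ∀ n, ∑ m, (B n m : ℂ) * α m = β n := by
  obtain ⟨f, f1, f2, f3⟩ := tsc_flow G hG _ hs
  let W : V → V → ℝ := fun n m => f n m / ((α n).re * (α m).im - (α n).im * (α m).re)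
  have W1 : ∀ n m, W n m = W m n := by
    intro n m
    simp only [W]
    rw [f1 n m, ← neg_div_neg_eq, neg_neg]
    congr 1
    ring
  have W2 : ∀ n m, W n m * ((α n).re * (α m).im - (α n).im * (α m).re) = f n m := by
    intro n m
    by_cases h : G.Adj n m
    · exact div_mul_cancel₀ _ (tsc_im_ne (hα n m h))
    · simp [W, f2 n m h]
  let d : V → ℝ := fun n =>
    (((α n).re * (β n).re + (α n).im * (β n).im)
      - ∑ m, W n m * ((α n).re * (α m).re + (α n).im * (α m).im))
      / ((α n).re * (α n).re + (α n).im * (α n).im)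
  refine ⟨fun n m => W n m + (if n = m then d n else 0), ?_, ?_, ?_⟩
  · ext n m
    change W m n + (if m = n then d m else 0) = W n m + (if n = m then d n else 0)
    rw [W1 m n]
    by_cases h : n = m
    · subst h; rfl
    · simp [h, Ne.symm h]
  · intro n m hnm h
    simp [hnm, W, f2 n m h]
  · intro n
    have hpos : (α n).re * (α n).re + (α n).im * (α n).im ≠ 0 := by
      have := h0 n
      rw [← Complex.normSq_apply]
      simpa using this
    have hd : d n * ((α n).re * (α n).re + (α n).im * (α n).im) = _ := div_mul_cancel₀ _ hpos
    have hf := f3 n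
    simp_rw [← W2] at hf
    set R := ∑ m, W n m * (α m).re with hR
    set I := ∑ m, W n m * (α m).im with hI
    have e1 : ∑ m, W n m * ((α n).re * (α m).im - (α n).im * (α m).re)
        = (α n).re * I - (α n).im * R := by
      rw [hI, hR, Finset.mul_sum, Finset.mul_sum, ← Finset.sum_sub_distrib]
      exact Finset.sum_congr rfl fun m _ => by ring
    have e2 : ∑ m, W n m * ((α n).re * (α m).re + (α n).im * (α m).im)
        = (α n).re * R + (α n).im * I := by
      rw [hI, hR, Finset.mul_sum, Finset.mul_sum, ← Finset.sum_add_distrib]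
      exact Finset.sum_congr rfl fun m _ => by ring
    rw [e1] at hf
    rw [e2] at hd
    have r1 : R + d n * (α n).re = (β n).re := by
      apply mul_left_cancel₀ hpos
      linear_combination (α n).re * hd - (α n).im * hf
    have r2 : I + d n * (α n).im = (β n).im := by
      apply mul_left_cancel₀ hpos
      linear_combination (α n).im * hd + (α n).re * hf
    apply Complex.ext
    · rw [← r1, Complex.re_sum]
      simp only [Complex.re_ofReal_mul, add_mul, Finset.sum_add_distrib]
      simp [hR]
    · rw [← r2, Complex.im_sum]
      simp only [Complex.im_ofReal_mul, add_mul, Finset.sum_add_distrib]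
      simp [hI]


/-- For a tree `G` on `Fin N` (`N ≥ 2`), `Z₀ > 0`, unit vectors
`u, h ∈ ℂ^N`, with `α = i Z₀ (u + h)` and `β = u − h`, if for every edge `{n,m}`
of `G` the numbers `α n, α m` are `ℝ`-linearly independent, then there exists a
real symmetric matrix `B` supported on `G` with `B · α = β`. -/
theorem tree_system_consistent {N : ℕ} (hN : 2 ≤ N) (G : SimpleGraph (Fin N))
    (hG : G.IsTree) (Z₀ : ℝ) (hZ : 0 < Z₀) (u h : EuclideanSpace ℂ (Fin N))
    (hu : ‖u‖ = 1) (hh : ‖h‖ = 1)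
    (hα : ∀ n m, G.Adj n m →
      LinearIndependent ℝ ![Complex.I * Z₀ * (u n + h n), Complex.I * Z₀ * (u m + h m)]) :
    ∃ B : Matrix (Fin N) (Fin N) ℝ, B.IsSymm ∧ SupportedOn G B ∧
      (B.map Complex.ofReal).mulVec (fun n => Complex.I * Z₀ * (u n + h n)) =
        fun n => u n - h n := by

  have : Nontrivial (Fin N) := Fin.nontrivial_iff_two_le.2 hN
  have h0 : ∀ n, Complex.I * Z₀ * (u n + h n) ≠ 0 := by
    intro n
    obtain ⟨m, hm⟩ := hG.connected.preconnected.exists_adj_of_nontrivial n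
    exact (hα n m hm).ne_zero 0
  have hs : ∑ n, ((u n).re ^ 2 + (u n).im ^ 2) = ∑ n, ((h n).re ^ 2 + (h n).im ^ 2) := by
    have a1 := EuclideanSpace.norm_sq_eq u
    have a2 := EuclideanSpace.norm_sq_eq h
    rw [hu] at a1
    rw [hh, a1] at a2
    simp only [Complex.sq_norm, Complex.normSq_apply, ← pow_two] at a2
    exact a2
  obtain ⟨B, b1, b2, b3⟩ := tsc_main G hG.connected
    (fun n => Complex.I * Z₀ * (u n + h n)) (fun n => u n - h n) h0 hα (by
      have : ∀ n, (Complex.I * Z₀ * (u n + h n)).re * (u n - h n).im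
          - (Complex.I * Z₀ * (u n + h n)).im * (u n - h n).re
          = -Z₀ * (((u n).re ^ 2 + (u n).im ^ 2) - ((h n).re ^ 2 + (h n).im ^ 2)) := by
        intro n
        simp
        ring
      simp_rw [this]
      rw [← Finset.mul_sum, Finset.sum_sub_distrib, hs, sub_self, mul_zero])
  refine ⟨B, b1, b2, ?_⟩
  funext n
  rw [← b3 n]
  rfl
end

section
/- Let N ≥ 2, let G be a tree on the vertex set Fin N, let Z₀ > 0 be real, and let u, h ∈ ℂ^N with ‖u‖ = 1 and ‖h‖ = 1. Define α = i·Z₀·(u + h) and β = u − h, and assume that for every edge {n,m} of G the complex numbers α_n and α_m are ℝ-linearly independent. Then there exists exactly one real symmetric N×N matrix B supported on G such that B·α = β. -/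
lemma tree_core (n : ℕ) : ∀ (V : Type) [Fintype V] [DecidableEq V] (G : SimpleGraph V),
    G.IsTree → Fintype.card V = n → ∀ x y p q : V → ℝ, (∀ i, x i ≠ 0 ∨ y i ≠ 0) →
    (∀ i j, G.Adj i j → x i * y j - y i * x j ≠ 0) →
    (∑ i, (x i * q i - y i * p i) = 0) →
    ∃! B : V → V → ℝ, (∀ i j, B i j = B j i) ∧ (∀ i j, i ≠ j → ¬ G.Adj i j → B i j = 0) ∧
      (∀ i, ∑ j, B i j * x j = p i) ∧ (∀ i, ∑ j, B i j * y j = q i) := by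
  classical
  induction n with
  | zero =>
    intro V _ _ G hG hc
    have := hG.connected.nonempty
    exact absurd hc Fintype.card_ne_zero
  | succ n ih =>
    intro V _ _ G hG hc x y p q hne hadj hsum
    rcases subsingleton_or_nontrivial V with hV | hV
    · obtain ⟨v⟩ := hG.connected.nonempty
      have key : ∀ f : V → ℝ, ∑ i, f i = f v := fun f =>
        Fintype.sum_eq_single v (fun i hi => absurd (Subsingleton.elim i v) hi)
      simp only [key] at hsum ⊢
      have hall : ∀ i : V, i = v := fun i => Subsingleton.elim i v
      rcases hne v with h0 | h0
      · refine ⟨fun _ _ => p v / x v, ⟨fun _ _ => rfl, fun i j hij => absurd (Subsingleton.elim i j) hij, fun i => ?_, fun i => ?_⟩, ?_⟩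
        · rw [hall i]; field_simp
        · rw [hall i]; field_simp; linarith
        · rintro B ⟨-, -, h1, -⟩
          funext i j
          rw [hall i, hall j, eq_div_iff h0, h1]
      · refine ⟨fun _ _ => q v / y v, ⟨fun _ _ => rfl, fun i j hij => absurd (Subsingleton.elim i j) hij, fun i => ?_, fun i => ?_⟩, ?_⟩
        · rw [hall i]; field_simp; linarith
        · rw [hall i]; field_simp
        · rintro B ⟨-, -, -, h1⟩
          funext i j
          rw [hall i, hall j, eq_div_iff h0, h1]
    · obtain ⟨v, hv⟩ := hG.exists_vert_degree_one_of_nontrivial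
      have hconn := hG.connected.induce_compl_singleton_of_degree_eq_one hv
      have hT : (G.induce ({v}ᶜ : Set V)).IsTree := ⟨hconn, hG.isAcyclic.induce _⟩
      obtain ⟨w, hw, hwu⟩ := SimpleGraph.degree_eq_one_iff_existsUnique_adj.1 hv
      have hwv : w ≠ v := hw.ne'
      have hD := hadj v w hw
      -- Cramer
      set D := x v * y w - y v * x w with hDdef
      set b := (p v * y w - q v * x w) / D with hb
      set c := (x v * q v - y v * p v) / D with hc'
      have e1 : b * x v + c * x w = p v := by
        rw [hb, hc']; field_simp; rw [hDdef]; ring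
      have e2 : b * y v + c * y w = q v := by
        rw [hb, hc']; field_simp; rw [hDdef]; ring
      let W := {i : V // i ≠ v}
      let w' : W := ⟨w, hwv⟩
      have split : ∀ f : V → ℝ, ∑ i, f i = f v + ∑ i : W, f i.1 := fun f =>
        Fintype.sum_eq_add_sum_subtype_ne f v
      have hcard : Fintype.card W = n := by
        have : Fintype.card W = Fintype.card V - 1 := Set.card_ne_eq v
        omega
      obtain ⟨B0, ⟨s0, z0, hx0, hy0⟩, hu0⟩ := ih W (G.induce ({v}ᶜ : Set V)) hT hcard
        (fun i => x i.1) (fun i => y i.1)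
        (fun i => p i.1 - if i.1 = w then c * x v else 0)
        (fun i => q i.1 - if i.1 = w then c * y v else 0)
        (fun i => hne i.1) (fun i j hij => hadj i.1 j.1 hij) (by
          rw [split] at hsum
          have : ∀ i : W, (x i.1 * (q i.1 - if i.1 = w then c * y v else 0)
            - y i.1 * (p i.1 - if i.1 = w then c * x v else 0)) =
            (x i.1 * q i.1 - y i.1 * p i.1) +
              (if i.1 = w then c * (y w * x v - x w * y v) else 0) := by
            intro i
            split_ifs with h
            · rw [h]; ring
            · ring
          have hs : ∑ i : W, (if i.1 = w then c * (y w * x v - x w * y v) else 0) =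
              c * (y w * x v - x w * y v) := by
            rw [Fintype.sum_eq_single w' (fun j hj => if_neg (fun h => hj (Subtype.ext h)))]
            exact if_pos rfl
          simp only [this, Finset.sum_add_distrib]
          rw [hs]
          rw [← e1, ← e2] at hsum
          linarith)
      -- action of a row
      have rowsum : ∀ f : V → ℝ, (∀ j, j ≠ v → j ≠ w → f j = 0) → ∑ j, f j = f v + f w := by
        intro f hf
        rw [split]
        congr 1
        exact Fintype.sum_eq_single w' (fun j hj => hf j.1 j.2 (fun h => hj (Subtype.ext h)))
      refine ⟨fun i j => if hi : i = v then (if j = v then b else if j = w then c else 0)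
        else if hj : j = v then (if i = w then c else 0) else B0 ⟨i, hi⟩ ⟨j, hj⟩,
        ⟨?_, ?_, ?_, ?_⟩, ?_⟩
      · intro i j
        by_cases hi : i = v <;> by_cases hj : j = v <;> simp [hi, hj]
        exact s0 _ _
      · intro i j hij hnadj
        by_cases hi : i = v
        · subst hi
          have : j ≠ w := by rintro rfl; exact hnadj hw
          simp [hij.symm, this]
        · by_cases hj : j = v
          · subst hj
            have : i ≠ w := by rintro rfl; exact hnadj hw.symm
            simp [hi, this]
          · simp only [hi, hj, dite_false]
            exact z0 _ _ (fun h => hij (congrArg Subtype.val h)) hnadj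
      · intro i
        by_cases hi : i = v
        · subst hi
          rw [rowsum _ (by intro j h1 h2; simp [h1, h2])]
          simpa [hwv] using e1
        · rw [split]
          have h := hx0 ⟨i, hi⟩
          have h2 : ∀ j : W, (j : V) ≠ v := fun j => j.2
          simp only [hi, h2, dite_false, dite_true] at h ⊢
          rw [h]
          split_ifs <;> ring
      · intro i
        by_cases hi : i = v
        · subst hi
          rw [rowsum _ (by intro j h1 h2; simp [h1, h2])]
          simpa [hwv] using e2
        · rw [split]
          have h := hy0 ⟨i, hi⟩
          have h2 : ∀ j : W, (j : V) ≠ v := fun j => j.2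
          simp only [hi, h2, dite_false, dite_true] at h ⊢
          rw [h]
          split_ifs <;> ring
      · rintro B ⟨s, z, hx, hy⟩
        have hz : ∀ j, j ≠ v → j ≠ w → B v j = 0 := fun j h1 h2 =>
          z v j h1.symm (fun h => h2 (hwu j h))
        have r1 := hx v
        have r2 := hy v
        rw [rowsum _ (by intro j h1 h2; simp [hz j h1 h2])] at r1 r2
        have hbv : B v v = b := by
          rw [hb, eq_div_iff hD, ← r1, ← r2, hDdef]; ring
        have hcv : B v w = c := by
          rw [hc', eq_div_iff hD, ← r1, ← r2, hDdef]; ring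
        have hvi : ∀ i : W, B i.1 v = if i.1 = w then c else 0 := by
          intro i
          rw [s]
          split_ifs with h
          · rw [h]; exact hcv
          · exact hz _ i.2 h
        have hB := hu0 (fun i j => B i.1 j.1) ⟨fun i j => s _ _,
          fun i j hij hn => z _ _ (fun h => hij (Subtype.ext h)) hn,
          fun i => by
            have := hx i.1
            rw [split, hvi] at this
            rw [← this]; split_ifs <;> ring,
          fun i => by
            have := hy i.1
            rw [split, hvi] at this
            rw [← this]; split_ifs <;> ring⟩
        funext i j
        by_cases hi : i = v
        · subst hi
          simp only [dite_true]
          split_ifs with h1 h2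
          · rw [h1, hbv]
          · rw [h2, hcv]
          · exact hz j h1 h2
        · by_cases hj : j = v
          · subst hj
            simp only [hi, dite_false, dite_true]
            exact hvi ⟨i, hi⟩
          · simp only [hi, hj, dite_false]
            rw [← hB]

lemma det_ne_zero_of_indep (z w : ℂ) (h : LinearIndependent ℝ ![z, w]) :
    z.re * w.im - z.im * w.re ≠ 0 := by
  intro hD
  rw [LinearIndependent.pair_iff] at h
  have h1 := h w.re (-z.re) (by apply Complex.ext <;> simp <;> linarith)
  have h2 := h w.im (-z.im) (by apply Complex.ext <;> simp <;> linarith)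
  have h3 := h 1 1 (by apply Complex.ext <;> simp <;> linarith)
  exact one_ne_zero h3.1

/-- For a tree `G` on `Fin N` (`N ≥ 2`), `Z₀ > 0`, unit vectors
`u, h ∈ ℂ^N`, with `α = i Z₀ (u + h)` and `β = u − h`, if for every edge `{n,m}`
of `G` the numbers `α n, α m` are `ℝ`-linearly independent, then there exists
exactly one real symmetric matrix `B` supported on `G` with `B · α = β`. -/
theorem tree_system_unique_solution {N : ℕ} (hN : 2 ≤ N) (G : SimpleGraph (Fin N))
    (hG : G.IsTree) (Z₀ : ℝ) (hZ : 0 < Z₀) (u h : EuclideanSpace ℂ (Fin N))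
    (hu : ‖u‖ = 1) (hh : ‖h‖ = 1)
    (hα : ∀ n m, G.Adj n m →
      LinearIndependent ℝ ![Complex.I * Z₀ * (u n + h n), Complex.I * Z₀ * (u m + h m)]) :
    ∃! B : Matrix (Fin N) (Fin N) ℝ, B.IsSymm ∧ SupportedOn G B ∧
      (B.map Complex.ofReal).mulVec (fun n => Complex.I * Z₀ * (u n + h n)) =
        fun n => u n - h n := by
  set α : Fin N → ℂ := fun n => Complex.I * Z₀ * (u n + h n) with hαdef
  have hdet : ∀ i j, G.Adj i j → (α i).re * (α j).im - (α i).im * (α j).re ≠ 0 :=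
    fun i j hij => det_ne_zero_of_indep _ _ (hα i j hij)
  have : Nontrivial (Fin N) := Fin.nontrivial_iff_two_le.2 hN
  have hu2 : ∑ i, ((u i).re ^ 2 + (u i).im ^ 2) = 1 := by
    have := EuclideanSpace.norm_sq_eq u
    rw [hu] at this
    simp only [Complex.sq_norm, Complex.normSq_apply] at this
    rw [← one_pow 2, this]
    exact Finset.sum_congr rfl fun i _ => by ring
  have hh2 : ∑ i, ((h i).re ^ 2 + (h i).im ^ 2) = 1 := by
    have := EuclideanSpace.norm_sq_eq h
    rw [hh] at this
    simp only [Complex.sq_norm, Complex.normSq_apply] at this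
    rw [← one_pow 2, this]
    exact Finset.sum_congr rfl fun i _ => by ring
  have core := tree_core N (Fin N) G hG (Fintype.card_fin N)
    (fun i => (α i).re) (fun i => (α i).im) (fun i => (u i - h i).re) (fun i => (u i - h i).im)
    (by
      intro i
      obtain ⟨j, hj⟩ := hG.connected.preconnected.exists_adj_of_nontrivial i
      by_contra! hc
      exact hdet i j hj (by simp [hc.1, hc.2]))
    hdet
    (by
      have : ∀ i, (α i).re * (u i - h i).im - (α i).im * (u i - h i).re =
          -Z₀ * (((u i).re ^ 2 + (u i).im ^ 2) - ((h i).re ^ 2 + (h i).im ^ 2)) := by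
        intro i
        simp [hαdef]
        ring
      simp only [this]
      rw [← Finset.mul_sum, Finset.sum_sub_distrib, hu2, hh2]
      simp)
  have iff : ∀ B : Matrix (Fin N) (Fin N) ℝ,
      (B.map Complex.ofReal).mulVec α = (fun n => u n - h n) ↔
      (∀ i, ∑ j, B i j * (α j).re = (u i - h i).re) ∧
      (∀ i, ∑ j, B i j * (α j).im = (u i - h i).im) := by
    intro B
    rw [funext_iff, ← forall_and]
    refine forall_congr' fun i => ?_
    rw [Complex.ext_iff]
    simp [Matrix.mulVec, dotProduct]
  obtain ⟨B, ⟨h1, h2, h3⟩, hB⟩ := core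
  refine ⟨B, ⟨Matrix.IsSymm.ext fun i j => h1 j i, h2, (iff B).2 h3⟩, ?_⟩
  rintro C ⟨c1, c2, c3⟩
  exact hB C ⟨fun i j => c1.apply j i, c2, (iff C).1 c3⟩
end

section
/- Let N ≥ 2, let G be a tree on the vertex set Fin N, let Z₀ > 0 be real, and let u, h ∈ ℂ^N with ‖u‖ = 1 and ‖h‖ = 1. Assume that for every edge {n,m} of G the complex numbers i·Z₀·(u_n + h_n) and i·Z₀·(u_m + h_m) are ℝ-linearly independent. Then there exists a real symmetric N×N matrix B supported on G such that the complex matrix I + i·Z₀·B is invertible and (I + i·Z₀·B)⁻¹·(I − i·Z₀·B)·u = h. -/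
open Matrix in
/-- Every difference of indicator vectors is the divergence of an antisymmetric flow. -/
lemma flow_pair {V : Type*} [Fintype V] [DecidableEq V] (G : SimpleGraph V)
    (S : Submodule ℝ (V → ℝ))
    (hS : ∀ d, d ∈ S ↔ ∃ f : V → V → ℝ, (∀ n m, f n m = - f m n) ∧
      (∀ n m, ¬ G.Adj n m → f n m = 0) ∧ ∀ n, ∑ m, f n m = d n)
    {x y : V} (p : G.Walk x y) : (Pi.single x 1 - Pi.single y 1 : V → ℝ) ∈ S := by
  induction p with
  | nil => simp
  | @cons a b c hab _ ih =>
    have h1 : (Pi.single a 1 - Pi.single b 1 : V → ℝ) ∈ S := by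
      rw [hS]
      have hne := hab.ne
      refine ⟨fun n m => (Pi.single a 1 : V → ℝ) n * (Pi.single b 1 : V → ℝ) m
        - (Pi.single b 1 : V → ℝ) n * (Pi.single a 1 : V → ℝ) m, ?_, ?_, ?_⟩
      · intro n m; ring
      · intro n m hnm
        simp only [Pi.single_apply]
        have := hab.symm
        split_ifs <;> simp_all
      · intro n
        rw [Finset.sum_sub_distrib, ← Finset.mul_sum, ← Finset.mul_sum]
        simp
    have := S.add_mem h1 ih
    simpa using this

lemma flow_exists {V : Type*} [Fintype V] (G : SimpleGraph V)
    (hG : G.Connected) (d : V → ℝ) (hd : ∑ n, d n = 0) :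
    ∃ f : V → V → ℝ, (∀ n m, f n m = - f m n) ∧
      (∀ n m, ¬ G.Adj n m → f n m = 0) ∧ ∀ n, ∑ m, f n m = d n := by
  classical
  let S : Submodule ℝ (V → ℝ) :=
    { carrier := {d | ∃ f : V → V → ℝ, (∀ n m, f n m = - f m n) ∧
        (∀ n m, ¬ G.Adj n m → f n m = 0) ∧ ∀ n, ∑ m, f n m = d n}
      zero_mem' := ⟨fun _ _ => 0, by simp, by simp, by simp⟩
      add_mem' := by
        rintro d e ⟨f, h1, h2, h3⟩ ⟨g, k1, k2, k3⟩
        refine ⟨fun n m => f n m + g n m, ?_, ?_, ?_⟩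
        · intro n m; simp only []; rw [h1, k1]; ring
        · intro n m h; simp only []; rw [h2 n m h, k2 n m h]; simp
        · intro n; rw [Finset.sum_add_distrib, h3, k3]; rfl
      smul_mem' := by
        rintro c d ⟨f, h1, h2, h3⟩
        refine ⟨fun n m => c * f n m, ?_, ?_, ?_⟩
        · intro n m; simp only []; rw [h1]; ring
        · intro n m h; simp only []; rw [h2 n m h]; simp
        · intro n; rw [← Finset.mul_sum, h3]; rfl }
  have hS : ∀ d, d ∈ S ↔ ∃ f : V → V → ℝ, (∀ n m, f n m = - f m n) ∧
      (∀ n m, ¬ G.Adj n m → f n m = 0) ∧ ∀ n, ∑ m, f n m = d n := fun d => Iff.rfl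
  rw [← hS]
  obtain ⟨r⟩ := hG.nonempty
  have key : d = ∑ n, d n • (Pi.single n 1 - Pi.single r 1 : V → ℝ) := by
    ext k
    simp only [smul_sub, Finset.sum_sub_distrib, ← Finset.sum_smul, hd]
    simp [Finset.sum_apply, Pi.single_apply]
  rw [key]
  refine S.sum_mem fun n _ => S.smul_mem _ ?_
  obtain ⟨p⟩ := hG.preconnected n r
  exact flow_pair G S hS p

lemma real_multiple {a x : ℂ} (ha : a ≠ 0) (h : (star a * x).im = 0) :
    ∃ r : ℝ, x = r * a := by
  refine ⟨(star a * x).re / Complex.normSq a, ?_⟩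
  have h1 : (((star a * x).re : ℝ) : ℂ) = star a * x := by
    apply Complex.ext <;> simp only [Complex.ofReal_re, Complex.ofReal_im, h]
  have h2 : (Complex.normSq a : ℂ) ≠ 0 := by simpa using ha
  rw [Complex.ofReal_div, h1, div_mul_eq_mul_div, eq_div_iff h2, Complex.normSq_eq_conj_mul_self]
  simp only [Complex.star_def]
  ring

lemma im_ne_zero_of_indep {a b : ℂ} (h : LinearIndependent ℝ ![a, b]) :
    a ≠ 0 ∧ (star a * b).im ≠ 0 := by
  have ha : a ≠ 0 := by simpa using h.ne_zero 0
  refine ⟨ha, fun h0 => ?_⟩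
  obtain ⟨r, hr⟩ := real_multiple ha h0
  rw [LinearIndependent.pair_iff] at h
  have := (h r (-1) (by simp [hr])).2
  norm_num at this

/-- Solving `B a = c` with `B` real symmetric supported on a connected graph. -/
lemma solve_on_graph {N : ℕ} (hN : 2 ≤ N) (G : SimpleGraph (Fin N)) (hG : G.Connected)
    (a c : Fin N → ℂ) (hα : ∀ n m, G.Adj n m → LinearIndependent ℝ ![a n, a m])
    (hsum : ∑ n, (star (a n) * c n).im = 0) :
    ∃ B : Matrix (Fin N) (Fin N) ℝ, B.IsSymm ∧ SupportedOn G B ∧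
      (B.map Complex.ofReal).mulVec a = c := by
  obtain ⟨f, hf1, hf2, hf3⟩ := flow_exists G hG _ hsum
  have ha : ∀ n, a n ≠ 0 := by
    intro n
    have : Nontrivial (Fin N) := Fin.nontrivial_iff_two_le.mpr hN
    obtain ⟨m, hm⟩ := hG.preconnected.exists_adj_of_nontrivial n
    exact (im_ne_zero_of_indep (hα n m hm)).1
  let w : Fin N → Fin N → ℝ := fun n m => (star (a n) * a m).im
  have hw : ∀ n m, w n m = - w m n := by
    intro n m; simp [w]; ring
  let E : Fin N → Fin N → ℝ := fun n m => f n m / w n m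
  have hE : ∀ n m, E n m = E m n := by
    intro n m; simp only [E]; rw [hf1, hw, neg_div_neg_eq]
  have hEw : ∀ n m, E n m * w n m = f n m := by
    intro n m
    by_cases h : G.Adj n m
    · exact div_mul_cancel₀ _ (im_ne_zero_of_indep (hα n m h)).2
    · simp [E, hf2 n m h]
  have hr : ∀ n, ∃ r : ℝ, c n - ∑ m, (E n m : ℂ) * a m = r * a n := by
    intro n
    refine real_multiple (ha n) ?_
    rw [mul_sub, Complex.sub_im, Finset.mul_sum, Complex.im_sum, ← hf3 n, sub_eq_zero]
    refine Finset.sum_congr rfl fun m _ => ?_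
    rw [← hEw, mul_left_comm, Complex.im_ofReal_mul]
  choose r hr using hr
  refine ⟨Matrix.of E + Matrix.diagonal r, ?_, ?_, ?_⟩
  · refine Matrix.IsSymm.add ?_ (Matrix.isSymm_diagonal r)
    ext n m; exact hE m n
  · intro n m hnm h
    simp [Matrix.diagonal_apply_ne _ hnm, E, hf2 n m h]
  · ext n
    have : (Matrix.of E + Matrix.diagonal r).map Complex.ofReal
        = (Matrix.of E).map Complex.ofReal + Matrix.diagonal (fun i => (r i : ℂ)) := by
      ext i j
      by_cases hij : i = j
      · subst hij; simp
      · simp [hij]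
    rw [this, Matrix.add_mulVec, Pi.add_apply, Matrix.mulVec_diagonal, ← hr n]
    simp [Matrix.mulVec, dotProduct]

open scoped ComplexOrder in
lemma isUnit_one_add {N : ℕ} (B : Matrix (Fin N) (Fin N) ℝ) (hB : B.IsSymm) (Z : ℝ) :
    IsUnit ((1 : Matrix (Fin N) (Fin N) ℂ) + (Complex.I * Z) • B.map Complex.ofReal) := by
  set M : Matrix (Fin N) (Fin N) ℂ := (Complex.I * Z) • B.map Complex.ofReal with hM
  have hMH : M.conjTranspose = - M := by
    ext i j
    simp [hM, Matrix.conjTranspose_apply, hB.apply i j]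
  have hpd : (1 + M.conjTranspose * M).PosDef :=
    Matrix.PosDef.one.add_posSemidef (Matrix.posSemidef_conjTranspose_mul_self M)
  have hu := hpd.isUnit
  have : 1 + M.conjTranspose * M = (1 - M) * (1 + M) := by
    rw [hMH]; noncomm_ring
  rw [this, Matrix.isUnit_iff_isUnit_det, Matrix.det_mul] at hu
  rw [Matrix.isUnit_iff_isUnit_det]
  exact isUnit_of_mul_isUnit_right hu

/-- For a tree `G` on `Fin N` (`N ≥ 2`), `Z₀ > 0`, and unit
vectors `u, h ∈ ℂ^N` such that for every edge `{n,m}` of `G` the numbers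
`i Z₀ (u n + h n)` and `i Z₀ (u m + h m)` are `ℝ`-linearly independent, there
exists a real symmetric matrix `B` supported on `G` such that `I + i Z₀ B` is
invertible and `(I + i Z₀ B)⁻¹ (I − i Z₀ B) u = h`. -/
theorem tree_scattering_exists {N : ℕ} (hN : 2 ≤ N) (G : SimpleGraph (Fin N))
    (hG : G.IsTree) (Z₀ : ℝ) (hZ : 0 < Z₀) (u h : EuclideanSpace ℂ (Fin N))
    (hu : ‖u‖ = 1) (hh : ‖h‖ = 1)
    (hα : ∀ n m, G.Adj n m →
      LinearIndependent ℝ ![Complex.I * Z₀ * (u n + h n), Complex.I * Z₀ * (u m + h m)]) :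
    ∃ B : Matrix (Fin N) (Fin N) ℝ, B.IsSymm ∧ SupportedOn G B ∧
      IsUnit ((1 : Matrix (Fin N) (Fin N) ℂ) + (Complex.I * Z₀) • B.map Complex.ofReal) ∧
      (((1 : Matrix (Fin N) (Fin N) ℂ) + (Complex.I * Z₀) • B.map Complex.ofReal)⁻¹ *
          ((1 : Matrix (Fin N) (Fin N) ℂ) - (Complex.I * Z₀) • B.map Complex.ofReal)).mulVec u
        = fun n => h n := by
  have hsum : ∑ n, (star (Complex.I * Z₀ * (u n + h n)) * (u n - h n)).im = 0 := by
    have e : ∀ n, (star (Complex.I * Z₀ * (u n + h n)) * (u n - h n)).im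
        = -Z₀ * (‖u n‖ ^ 2 - ‖h n‖ ^ 2) := by
      intro n
      rw [← Complex.normSq_eq_norm_sq, ← Complex.normSq_eq_norm_sq]
      simp [Complex.normSq_apply]
      ring
    simp only [e]
    rw [← Finset.mul_sum, Finset.sum_sub_distrib, ← EuclideanSpace.norm_sq_eq,
      ← EuclideanSpace.norm_sq_eq, hu, hh]
    simp
  obtain ⟨B, hB1, hB2, hB3⟩ := solve_on_graph hN G hG.connected
    (fun n => Complex.I * Z₀ * (u n + h n)) (fun n => u n - h n) hα hsum
  have hunit := isUnit_one_add B hB1 Z₀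
  refine ⟨B, hB1, hB2, hunit, ?_⟩
  have hdet := (Matrix.isUnit_iff_isUnit_det _).mp hunit
  have key : ((1 : Matrix (Fin N) (Fin N) ℂ) - (Complex.I * Z₀) • B.map Complex.ofReal).mulVec u
      = ((1 : Matrix (Fin N) (Fin N) ℂ) + (Complex.I * Z₀) • B.map Complex.ofReal).mulVec
        (fun n => h n) := by
    have e : (fun n => Complex.I * Z₀ * (u n + h n))
        = (Complex.I * Z₀) • ((fun n => u n) + fun n => h n) := by
      ext n; simp
    rw [e, Matrix.mulVec_smul, Matrix.mulVec_add, smul_add] at hB3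
    rw [Matrix.sub_mulVec, Matrix.add_mulVec, Matrix.one_mulVec, Matrix.one_mulVec,
      Matrix.smul_mulVec, Matrix.smul_mulVec]
    ext n
    have := congrFun hB3 n
    simp only [Pi.add_apply, Pi.sub_apply] at this ⊢
    linear_combination -this
  rw [← Matrix.mulVec_mulVec, key, Matrix.mulVec_mulVec, Matrix.nonsing_inv_mul _ hdet,
    Matrix.one_mulVec]
end
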